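/- arXiv:2207.09170 — 2 statements merged into one kernel-verified Lean document; each statement's English description precedes it below -/
import Mathlib

section
/- Let v ∈ ℂ^3 be a vector with |v_1|^2 + |v_2|^2 + |v_3|^2 = 1, let λ, λ' ∈ ℂ with |λ| = |λ'| = 1 and λ ≠ λ', and let ν_1, ν_2, ν_3 ∈ ℂ be pairwise distinct with |ν_i| = 1. Define A := λ·I + (λ' − λ)·v·v* (the unitary matrix acting as λ on the orthogonal complement of v and as λ' on ℂ·v) and B := diag(ν_1, ν_2, ν_3). Then the pair (A,B) is irreducible (the only subspaces W ⊆ ℂ^3 with A·W ⊆ W and B·W ⊆ W are 0 and ℂ^3) if and only if all three coordinates of v are nonzero. -/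
open Matrix in
/-- A submodule invariant under a diagonal matrix is invariant under every polynomial in it. -/
theorem Submodule.eval_mul_mem_of_diagonal_mulVec_mem {K ι : Type*} [Field K] [Fintype ι]
    [DecidableEq ι] {ν : ι → K} {W : Submodule K (ι → K)}
    (hW : ∀ x ∈ W, diagonal ν *ᵥ x ∈ W) (p : Polynomial K) {x : ι → K} (hx : x ∈ W) :
    (fun i => p.eval (ν i) * x i) ∈ W := by
  induction p using Polynomial.induction_on with
  | C a =>
    convert W.smul_mem a hx using 1
    ext i
    simp
  | add p q hp hq =>
    convert W.add_mem hp hq using 1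
    ext i
    simp [add_mul]
  | monomial n a h =>
    convert hW _ h using 1
    ext i
    simp [mulVec_diagonal, pow_succ]
    ring

open Matrix in
/-- A submodule invariant under a diagonal matrix with distinct entries contains the coordinate
components of each of its vectors. -/
theorem Submodule.single_mem_of_diagonal_mulVec_mem {K ι : Type*} [Field K] [Fintype ι]
    [DecidableEq ι] {ν : ι → K} (hν : Function.Injective ν) {W : Submodule K (ι → K)}
    (hW : ∀ x ∈ W, diagonal ν *ᵥ x ∈ W) {x : ι → K} (hx : x ∈ W) {i : ι} (hi : x i ≠ 0) :
    Pi.single i 1 ∈ W := by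
  convert W.smul_mem (x i)⁻¹
    (W.eval_mul_mem_of_diagonal_mulVec_mem hW (Lagrange.basis Finset.univ ν i) hx) using 1
  ext j
  obtain rfl | hij := eq_or_ne i j
  · simp [Lagrange.eval_basis_self hν.injOn (Finset.mem_univ i), hi]
  · simp [Lagrange.eval_basis_of_ne hij (Finset.mem_univ j), hij.symm]

open Matrix in
/-- The action of a rank-one perturbation of a scalar matrix. -/
theorem Matrix.smul_one_add_smul_rankOne_mulVec {ι : Type*} [Fintype ι] [DecidableEq ι]
    (a b : ℂ) (v x : ι → ℂ) :
    (a • (1 : Matrix ι ι ℂ) +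
      b • Matrix.of (fun i j => v i * (starRingEnd ℂ) (v j))) *ᵥ x =
      a • x + (b * (star v ⬝ᵥ x)) • v := by
  have h : Matrix.of (fun i j => v i * (starRingEnd ℂ) (v j)) = vecMulVec v (star v) := rfl
  rw [h, add_mulVec, smul_mulVec, smul_mulVec, one_mulVec, vecMulVec_mulVec, op_smul_eq_smul,
    smul_smul]

/-- Let `v ∈ ℂ³` be a unit vector, `λ ≠ λ'` of modulus one, and `ν₁, ν₂, ν₃` pairwise
distinct of modulus one. Let `A = λ·I + (λ' - λ)·v v*` and `B = diag(ν₁, ν₂, ν₃)`. Then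
the pair `(A, B)` is irreducible iff all three coordinates of `v` are nonzero. -/
theorem stmt_10 (v : Fin 3 → ℂ) (hv : ∑ i, ‖v i‖ ^ 2 = 1)
    (lam lam' : ℂ) (hlam : ‖lam‖ = 1) (hlam' : ‖lam'‖ = 1)
    (hne : lam ≠ lam')
    (ν : Fin 3 → ℂ) (hν : ∀ i, ‖ν i‖ = 1)
    (hνdist : ∀ i j, i ≠ j → ν i ≠ ν j) :
    (∀ W : Submodule ℂ (Fin 3 → ℂ),
        (∀ x ∈ W,
          (lam • (1 : Matrix (Fin 3) (Fin 3) ℂ) +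
            (lam' - lam) • Matrix.of (fun i j => v i * (starRingEnd ℂ) (v j))).mulVec x ∈ W) →
        (∀ x ∈ W, (Matrix.diagonal ν).mulVec x ∈ W) →
        W = ⊥ ∨ W = ⊤) ↔
      ∀ i, v i ≠ 0 := by
  have hinj : Function.Injective ν := fun i j h => by_contra fun hij => hνdist i j hij h
  simp only [Matrix.smul_one_add_smul_rankOne_mulVec]
  constructor
  · intro h i hi
    have hA : ∀ x ∈ Submodule.span ℂ {(Pi.single i 1 : Fin 3 → ℂ)},
        lam • x + ((lam' - lam) * (star v ⬝ᵥ x)) • v ∈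
          Submodule.span ℂ {(Pi.single i 1 : Fin 3 → ℂ)} := by
      intro x hx
      obtain ⟨c, rfl⟩ := Submodule.mem_span_singleton.1 hx
      simpa [hi] using Submodule.smul_mem _ lam hx
    have hB : ∀ x ∈ Submodule.span ℂ {(Pi.single i 1 : Fin 3 → ℂ)},
        (Matrix.diagonal ν).mulVec x ∈ Submodule.span ℂ {(Pi.single i 1 : Fin 3 → ℂ)} := by
      intro x hx
      obtain ⟨c, rfl⟩ := Submodule.mem_span_singleton.1 hx
      refine Submodule.mem_span_singleton.2 ⟨c * ν i, ?_⟩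
      ext j
      obtain rfl | hij := eq_or_ne j i
      · simp [Matrix.mulVec_diagonal, mul_comm]
      · simp [Matrix.mulVec_diagonal, hij]
    rcases h _ hA hB with hW | hW
    · simp at hW
    · obtain ⟨j, hj⟩ := exists_ne i
      have hmem : (Pi.single j 1 : Fin 3 → ℂ) ∈ Submodule.span ℂ {Pi.single i (1 : ℂ)} :=
        hW ▸ Submodule.mem_top
      obtain ⟨c, hc⟩ := Submodule.mem_span_singleton.1 hmem
      simpa [hj] using congrFun hc j
  · intro hv0 W hA hB
    refine or_iff_not_imp_left.2 fun hW => ?_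
    obtain ⟨x, hx, hx0⟩ := W.ne_bot_iff.1 hW
    obtain ⟨i, hi⟩ := Function.ne_iff.1 hx0
    have he := W.single_mem_of_diagonal_mulVec_mem hinj hB hx hi
    have hvW : v ∈ W := by
      have h := (W.add_mem_iff_right (W.smul_mem lam he)).1 (hA _ he)
      refine (W.smul_mem_iff ?_).1 h
      simpa [sub_eq_zero, hv0 i] using hne.symm
    refine Submodule.eq_top_iff'.2 fun y => ?_
    rw [pi_eq_sum_univ' y]
    exact W.sum_mem fun j _ => W.smul_mem _
      (W.single_mem_of_diagonal_mulVec_mem hinj hB hvW (hv0 j))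
end

section
/- Let n, m be coprime positive integers and let A, B be 2×2 complex unitary matrices with A^n = B^m. Assume the pair (A,B) is irreducible, i.e. the only subspaces W ⊆ ℂ^2 with A·W ⊆ W and B·W ⊆ W are 0 and ℂ^2. Then there exist t ∈ ℂ with |t| = 1, ε ∈ ℂ with ε^n = 1 and ε ≠ 1, and ε' ∈ ℂ with ε'^m = 1 and ε' ≠ 1, such that the multiset of eigenvalues of A is {t^m, t^m·ε} and the multiset of eigenvalues of B is {t^n, t^n·ε'}. -/
open Polynomial in
/-- A non-scalar `2×2` complex matrix with a nonzero scalar `n`-th power `ω` has two distinct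
eigenvalues, both `n`-th roots of `ω`. -/
theorem exists_charpoly_roots_eq_pair_of_pow_eq_scalar {n : ℕ} (hn : 0 < n)
    {A : Matrix (Fin 2) (Fin 2) ℂ} {ω : ℂ} (hω : ω ≠ 0) (hA : A ^ n = algebraMap ℂ _ ω)
    (hscalar : ∀ c : ℂ, A ≠ algebraMap ℂ _ c) :
    ∃ a b : ℂ, a ≠ b ∧ a ^ n = ω ∧ b ^ n = ω ∧ A.charpoly.roots = {a, b} := by
  have hsplit : A.charpoly.Splits := IsAlgClosed.splits _
  have hcard : A.charpoly.roots.card = 2 := by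
    rw [← hsplit.natDegree_eq_card_roots, Matrix.charpoly_natDegree_eq_dim, Fintype.card_fin]
  obtain ⟨a, b, hab⟩ := Multiset.card_eq_two.mp hcard
  have hpow : ∀ x ∈ A.charpoly.roots, x ^ n = ω := by
    intro x hx
    have hmem : x ∈ spectrum ℂ A :=
      Matrix.mem_spectrum_iff_isRoot_charpoly.mpr (isRoot_of_mem_roots hx)
    have hmem_pow := spectrum.pow_mem_pow A n hmem
    rwa [hA, spectrum.scalar_eq, Set.mem_singleton_iff] at hmem_pow
  refine ⟨a, b, ?_, hpow a (by simp [hab]), hpow b (by simp [hab]), hab⟩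
  rintro rfl
  have hchar : A.charpoly = (X - C a) ^ 2 := by
    rw [hsplit.eq_prod_roots_of_monic A.charpoly_monic, hab]
    simp [sq]
  have hdvd : minpoly ℂ A ∣ X ^ n - C ω := minpoly.dvd _ _ (by simp [hA])
  have hsq : Squarefree (minpoly ℂ A) :=
    (separable_X_pow_sub_C ω (by exact_mod_cast hn.ne') hω).squarefree.squarefree_of_dvd hdvd
  have hlin : minpoly ℂ A ∣ X - C a := by
    rw [← hsq.dvd_pow_iff_dvd two_ne_zero, ← hchar]
    exact Matrix.minpoly_dvd_charpoly A
  have haeval := (minpoly.dvd_iff).mp hlin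
  rw [map_sub, aeval_X, aeval_C, sub_eq_zero] at haeval
  exact hscalar a haeval

/-- Schur's lemma for an irreducible pair of matrices. -/
theorem exists_eq_algebraMap_of_commute {A B C : Matrix (Fin 2) (Fin 2) ℂ}
    (hirr : ∀ W : Submodule ℂ (Fin 2 → ℂ),
      (∀ v ∈ W, A.mulVec v ∈ W) → (∀ v ∈ W, B.mulVec v ∈ W) → W = ⊥ ∨ W = ⊤)
    (hCA : Commute C A) (hCB : Commute C B) : ∃ c : ℂ, C = algebraMap ℂ _ c := by
  obtain ⟨c, hc⟩ := Module.End.exists_eigenvalue (Matrix.toLin' C)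
  have hinv : ∀ D, Commute C D → ∀ v ∈ Module.End.eigenspace (Matrix.toLin' C) c,
      D.mulVec v ∈ Module.End.eigenspace (Matrix.toLin' C) c := by
    intro D hD v hv
    rw [Module.End.mem_eigenspace_iff, Matrix.toLin'_apply] at hv ⊢
    rw [Matrix.mulVec_mulVec, hD.eq, ← Matrix.mulVec_mulVec, hv, Matrix.mulVec_smul]
  have htop := (hirr _ (hinv A hCA) (hinv B hCB)).resolve_left hc
  refine ⟨c, Matrix.toLin'.injective (LinearMap.ext fun v => ?_)⟩
  have hv : v ∈ Module.End.eigenspace (Matrix.toLin' C) c := htop ▸ Submodule.mem_top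
  rw [Module.End.mem_eigenspace_iff] at hv
  rw [hv, Matrix.toLin'_apply, Algebra.algebraMap_eq_smul_one, Matrix.smul_mulVec,
    Matrix.one_mulVec]

/-- The members of an irreducible pair of `2×2` matrices do not commute. -/
theorem not_commute_of_irreducible {A B : Matrix (Fin 2) (Fin 2) ℂ}
    (hirr : ∀ W : Submodule ℂ (Fin 2 → ℂ),
      (∀ v ∈ W, A.mulVec v ∈ W) → (∀ v ∈ W, B.mulVec v ∈ W) → W = ⊥ ∨ W = ⊤) :
    ¬ Commute A B := by
  intro hcomm
  obtain ⟨a, rfl⟩ := exists_eq_algebraMap_of_commute hirr (Commute.refl A) hcomm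
  obtain ⟨b, rfl⟩ := exists_eq_algebraMap_of_commute hirr hcomm.symm (Commute.refl B)
  have hinv : ∀ (W : Submodule ℂ (Fin 2 → ℂ)) (c : ℂ), ∀ v ∈ W,
      (algebraMap ℂ (Matrix (Fin 2) (Fin 2) ℂ) c).mulVec v ∈ W := by
    intro W c v hv
    rw [Algebra.algebraMap_eq_smul_one, Matrix.smul_mulVec, Matrix.one_mulVec]
    exact W.smul_mem c hv
  rcases hirr (LinearMap.ker (LinearMap.proj 0)) (hinv _ a) (hinv _ b) with h | h
  · have hmem : (![0, 1] : Fin 2 → ℂ) ∈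
        LinearMap.ker (LinearMap.proj 0 : (Fin 2 → ℂ) →ₗ[ℂ] ℂ) := by simp
    rw [h, Submodule.mem_bot] at hmem
    simpa using congrFun hmem 1
  · have hmem : (![1, 0] : Fin 2 → ℂ) ∈
        LinearMap.ker (LinearMap.proj 0 : (Fin 2 → ℂ) →ₗ[ℂ] ℂ) := h ▸ Submodule.mem_top
    simp at hmem

/-- A scalar unitary matrix has a scalar of norm one. -/
theorem norm_eq_one_of_algebraMap_mem_unitaryGroup {c : ℂ}
    (hc : algebraMap ℂ (Matrix (Fin 2) (Fin 2) ℂ) c ∈ Matrix.unitaryGroup (Fin 2) ℂ) :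
    ‖c‖ = 1 := by
  have h := congrFun (congrFun (Matrix.mem_unitaryGroup_iff.mp hc) 0) 0
  rw [← algebraMap_star_comm, ← map_mul, Matrix.algebraMap_matrix_apply, if_pos rfl,
    Matrix.one_apply_eq] at h
  have hnorm := congrArg norm h
  simp only [Algebra.algebraMap_self, RingHom.id_apply, norm_mul, norm_star, norm_one] at hnorm
  nlinarith [norm_nonneg c]

/-- In a field, `a ^ n = b ^ m ≠ 0` with `n, m` coprime forces `a = t ^ m` and `b = t ^ n`. -/
theorem exists_pow_eq_and_pow_eq_of_coprime {K : Type*} [Field K] {n m : ℕ}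
    (hco : Nat.Coprime n m) {a b : K} (ha : a ≠ 0) (hb : b ≠ 0) (hab : a ^ n = b ^ m) :
    ∃ t : K, t ^ m = a ∧ t ^ n = b := by
  obtain ⟨u, v, huv⟩ := Nat.isCoprime_iff_coprime.mpr hco
  have hab' : a ^ (n : ℤ) = b ^ (m : ℤ) := by exact_mod_cast hab
  refine ⟨a ^ v * b ^ u, ?_, ?_⟩
  · calc (a ^ v * b ^ u) ^ m = a ^ (v * m) * (b ^ (m : ℤ)) ^ u := by
          rw [mul_pow, ← zpow_natCast, ← zpow_natCast, ← zpow_mul, ← zpow_mul, ← zpow_mul,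
            mul_comm u]
      _ = a ^ (u * n + v * m) := by
          rw [← hab', ← zpow_mul, ← zpow_add₀ ha]; congr 1; ring
      _ = a := by rw [huv, zpow_one]
  · calc (a ^ v * b ^ u) ^ n = (a ^ (n : ℤ)) ^ v * b ^ (u * n) := by
          rw [mul_pow, ← zpow_natCast, ← zpow_natCast, ← zpow_mul, ← zpow_mul, ← zpow_mul,
            mul_comm v]
      _ = b ^ (u * n + v * m) := by
          rw [hab', ← zpow_mul, ← zpow_add₀ hb]; congr 1; ring
      _ = b := by rw [huv, zpow_one]


/-- If `(A, B)` is an irreducible pair of `2×2` unitary matrices with `A ^ n = B ^ m`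
for coprime positive `n, m`, then there are `t` with `|t| = 1`, an `n`-th root of unity
`ε ≠ 1` and an `m`-th root of unity `ε' ≠ 1` such that the eigenvalues of `A` are
`{t^m, t^m ε}` and those of `B` are `{t^n, t^n ε'}`. -/
theorem stmt_12 (n m : ℕ) (hn : 0 < n) (hm : 0 < m) (hco : Nat.Coprime n m)
    (A B : Matrix (Fin 2) (Fin 2) ℂ)
    (hA : A ∈ Matrix.unitaryGroup (Fin 2) ℂ) (hB : B ∈ Matrix.unitaryGroup (Fin 2) ℂ)
    (hAB : A ^ n = B ^ m)
    (hirr : ∀ W : Submodule ℂ (Fin 2 → ℂ),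
      (∀ v ∈ W, A.mulVec v ∈ W) → (∀ v ∈ W, B.mulVec v ∈ W) → W = ⊥ ∨ W = ⊤) :
    ∃ (t ε ε' : ℂ), ‖t‖ = 1 ∧ ε ^ n = 1 ∧ ε ≠ 1 ∧ ε' ^ m = 1 ∧ ε' ≠ 1 ∧
      A.charpoly.roots = {t ^ m, t ^ m * ε} ∧
      B.charpoly.roots = {t ^ n, t ^ n * ε'} := by
  obtain ⟨ω, hω⟩ := exists_eq_algebraMap_of_commute hirr ((Commute.refl A).pow_left n)
    (hAB ▸ (Commute.refl B).pow_left m)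
  have hnorm : ‖ω‖ = 1 := norm_eq_one_of_algebraMap_mem_unitaryGroup (hω ▸ pow_mem hA n)
  have hω0 : ω ≠ 0 := norm_ne_zero_iff.mp (by simp [hnorm])
  have hncomm := not_commute_of_irreducible hirr
  obtain ⟨a, a', haa', han, han', hrootsA⟩ :=
    exists_charpoly_roots_eq_pair_of_pow_eq_scalar hn hω0 hω fun c hc =>
      hncomm (hc ▸ Algebra.commutes c B)
  obtain ⟨b, b', hbb', hbm, hbm', hrootsB⟩ :=
    exists_charpoly_roots_eq_pair_of_pow_eq_scalar hm hω0 (hAB.symm.trans hω) fun c hc =>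
      hncomm (hc ▸ (Algebra.commutes c A).symm)
  have ha : a ≠ 0 := by rintro rfl; exact hω0 (by rw [← han, zero_pow hn.ne'])
  have hb : b ≠ 0 := by rintro rfl; exact hω0 (by rw [← hbm, zero_pow hm.ne'])
  obtain ⟨t, hta, htb⟩ := exists_pow_eq_and_pow_eq_of_coprime hco ha hb (han.trans hbm.symm)
  refine ⟨t, a' / a, b' / b, ?_, ?_, ?_, ?_, ?_, ?_, ?_⟩
  · have htω : ‖t‖ ^ (m * n) = 1 := by rw [← norm_pow, pow_mul, hta, han, hnorm]
    exact (pow_eq_one_iff_of_nonneg (norm_nonneg t) (Nat.mul_pos hm hn).ne').mp htω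
  · rw [div_pow, han, han', div_self hω0]
  · rw [Ne, div_eq_one_iff_eq ha]
    exact haa'.symm
  · rw [div_pow, hbm, hbm', div_self hω0]
  · rw [Ne, div_eq_one_iff_eq hb]
    exact hbb'.symm
  · rw [hta, mul_div_cancel₀ _ ha, hrootsA]
  · rw [htb, mul_div_cancel₀ _ hb, hrootsB]
end
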